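/- Let k be an algebraically closed field of characteristic 0, d ≥ 1, and f a nonzero binary form of degree d over k. Then f has a linear factor of multiplicity strictly greater than d/2 if and only if I(f) = 0 for every homogeneous SL₂(k)-invariant I of positive degree for binary forms of degree d. Equivalently, f is semistable (some positive-degree homogeneous SL₂(k)-invariant does not vanish at f) if and only if every root of f has multiplicity at most d/2. -/

import Mathlib

open MvPolynomial

/-- The binary form of degree `d` with coefficient tuple `a`:
`f(x,y) = Σ_{i=0}^d a_i x^i y^{d-i}`, as a polynomial in `x = X 0`, `y = X 1`. -/
noncomputable def binForm {k : Type*} [CommRing k] (d : ℕ) (a : Fin (d + 1) → k) :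
    MvPolynomial (Fin 2) k :=
  ∑ i : Fin (d + 1), C (a i) * X 0 ^ (i : ℕ) * X 1 ^ (d - (i : ℕ))

/-- The coefficient tuple of the transformed form
`f^M(x,y) = f(M₀₀x + M₀₁y, M₁₀x + M₁₁y)`:  `transCoeff M d a i` is the coefficient
of `x^i y^{d-i}` in `f^M`. -/
noncomputable def transCoeff {k : Type*} [CommRing k] (M : Matrix (Fin 2) (Fin 2) k)
    (d : ℕ) (a : Fin (d + 1) → k) : Fin (d + 1) → k :=
  fun i => MvPolynomial.coeff
    (Finsupp.single (0 : Fin 2) (i : ℕ) + Finsupp.single (1 : Fin 2) (d - (i : ℕ)))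
    (MvPolynomial.bind₁ (fun j : Fin 2 => C (M j 0) * X 0 + C (M j 1) * X 1) (binForm d a))

/-- `I ∈ k[a₀, …, a_d]` is a homogeneous `SL₂(k)`-invariant of degree `s` for binary
forms of degree `d`: it is homogeneous of degree `s` in the coefficient variables and
`I(f^M) = I(f)` for every binary form `f` of degree `d` and every `M ∈ SL₂(k)`. -/
def IsBinaryInvariant {k : Type*} [CommRing k] (d s : ℕ) (I : MvPolynomial (Fin (d + 1)) k) :
    Prop :=
  I.IsHomogeneous s ∧
    ∀ (a : Fin (d + 1) → k) (M : Matrix (Fin 2) (Fin 2) k), M.det = 1 →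
      MvPolynomial.eval (transCoeff M d a) I = MvPolynomial.eval a I


/-- Coefficients of the product of the linear forms `p j x + q j y`. -/
noncomputable def prodCoeff {R : Type*} [CommRing R] {d : ℕ} (p q : Fin d → R)
    (i : Fin (d + 1)) : R :=
  (∏ j, (Polynomial.C (p j) * Polynomial.X + Polynomial.C (q j))).coeff i

lemma binForm_coeff_eq {k : Type*} [Field k] (d : ℕ) (F : Polynomial k) :
    binForm d (fun i => F.coeff i) = F.homogenize d := by
  rw [Polynomial.homogenize, Finset.Nat.sum_antidiagonal_eq_sum_range_succ_mk, binForm,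
    Finset.sum_range]
  refine Finset.sum_congr rfl fun i _ => ?_
  rw [Finsupp.update_eq_add_single (by simp), monomial_single_add, mul_assoc, mul_comm (C _),
    mul_assoc, mul_comm (X 1 ^ _), C_mul_X_pow_eq_monomial]

lemma exists_poly {k : Type*} [Field k] (d : ℕ) (a : Fin (d + 1) → k) :
    ∃ F : Polynomial k, F.natDegree ≤ d ∧ a = fun i : Fin (d + 1) => F.coeff i := by
  refine ⟨∑ i : Fin (d + 1), Polynomial.monomial (i : ℕ) (a i), ?_, ?_⟩
  · refine Polynomial.natDegree_sum_le_of_forall_le _ _ fun i _ => ?_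
    exact (Polynomial.natDegree_monomial_le _).trans (by omega)
  · funext i
    simp [Polynomial.finsetSum_coeff, Polynomial.coeff_monomial, Fin.val_inj]

lemma coeff_binForm {k : Type*} [Field k] (d : ℕ) (a : Fin (d + 1) → k) (i : Fin (d + 1)) :
    MvPolynomial.coeff (Finsupp.single (0 : Fin 2) (i : ℕ) + Finsupp.single (1 : Fin 2) (d - (i : ℕ)))
      (binForm d a) = a i := by
  obtain ⟨F, _, rfl⟩ := exists_poly d a
  rw [binForm_coeff_eq, Polynomial.coeff_homogenize]
  have : (i : ℕ) + (d - i) = d := by omega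
  simp [this]

lemma binForm_prodCoeff {k : Type*} [Field k] {d : ℕ} (p q : Fin d → k) :
    binForm d (prodCoeff p q) = ∏ j, (C (p j) * X 0 + C (q j) * X 1) := by
  have h := binForm_coeff_eq d (∏ j, (Polynomial.C (p j) * Polynomial.X + Polynomial.C (q j)))
  have h2 := Polynomial.homogenize_finsetProd (s := Finset.univ)
    (p := fun j => (Polynomial.C (p j) * Polynomial.X + Polynomial.C (q j))) (n := fun _ => 1)
    (fun i _ => Polynomial.natDegree_linear_le)
  simp only [Finset.sum_const, Finset.card_univ, Fintype.card_fin, smul_eq_mul, mul_one] at h2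
  rw [h2] at h
  refine Eq.trans h (Finset.prod_congr rfl fun j _ => ?_)
  simp

lemma exists_factor {k : Type*} [Field k] [IsAlgClosed k] (d : ℕ) :
    ∀ F : Polynomial k, F.natDegree ≤ d → ∃ (c : k) (p q : Fin d → k),
      F = Polynomial.C c * ∏ j, (Polynomial.C (p j) * Polynomial.X + Polynomial.C (q j)) := by
  induction d with
  | zero =>
    intro F hF
    refine ⟨F.coeff 0, 0, 0, ?_⟩
    simpa using Polynomial.eq_C_of_natDegree_le_zero hF
  | succ d ih =>
    intro F hF
    by_cases h : F.natDegree ≤ d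
    · obtain ⟨c, p, q, h⟩ := ih F h
      refine ⟨c, Fin.cons 0 p, Fin.cons 1 q, ?_⟩
      simp [Fin.prod_univ_succ, ← h]
    · have hd : F.natDegree = d + 1 := by omega
      have h0 : F.degree ≠ 0 := by
        intro h'
        have : F.natDegree = 0 := Polynomial.natDegree_eq_of_degree_eq_some h'
        omega
      obtain ⟨z, hz⟩ := IsAlgClosed.exists_root F h0
      obtain ⟨G, rfl⟩ := Polynomial.dvd_iff_isRoot.2 hz
      have hG : G ≠ 0 := by rintro rfl; simp at hd
      rw [Polynomial.natDegree_mul (Polynomial.X_sub_C_ne_zero z) hG,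
        Polynomial.natDegree_X_sub_C] at hd
      obtain ⟨c, p, q, h⟩ := ih G (by omega)
      refine ⟨c, Fin.cons 1 p, Fin.cons (-z) q, ?_⟩
      simp only [Fin.prod_univ_succ, Fin.cons_zero, Fin.cons_succ, map_one, map_neg]
      conv_lhs => rw [h]
      ring

lemma exists_prodCoeff {k : Type*} [Field k] [IsAlgClosed k] (d : ℕ) (hd : 1 ≤ d)
    (a : Fin (d + 1) → k) : ∃ p q : Fin d → k, a = prodCoeff p q := by
  obtain ⟨F, hF, rfl⟩ := exists_poly d a
  obtain ⟨c, p, q, rfl⟩ := exists_factor d F hF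
  obtain ⟨d, rfl⟩ : ∃ e, d = e + 1 := ⟨d - 1, by omega⟩
  refine ⟨Fin.cons (c * p 0) (Fin.tail p), Fin.cons (c * q 0) (Fin.tail q), ?_⟩
  funext i
  rw [prodCoeff]
  congr 1
  simp only [Fin.prod_univ_succ, Fin.cons_zero, Fin.cons_succ, map_mul, Fin.tail]
  ring

lemma transCoeff_prodCoeff {k : Type*} [Field k] {d : ℕ} (M : Matrix (Fin 2) (Fin 2) k)
    (p q : Fin d → k) :
    transCoeff M d (prodCoeff p q) =
      prodCoeff (fun i => p i * M 0 0 + q i * M 1 0) (fun i => p i * M 0 1 + q i * M 1 1) := by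
  funext i
  rw [transCoeff, ← coeff_binForm d (prodCoeff (fun i => p i * M 0 0 + q i * M 1 0) _) i,
    binForm_prodCoeff, binForm_prodCoeff]
  congr 1
  simp only [map_prod, map_add, map_mul, bind₁_C_right, bind₁_X_right]
  refine Finset.prod_congr rfl fun j _ => ?_
  ring

lemma prodCoeff_map {R S : Type*} [CommRing R] [CommRing S] (φ : R →+* S) {d : ℕ}
    (p q : Fin d → R) (i : Fin (d + 1)) :
    φ (prodCoeff p q i) = prodCoeff (fun j => φ (p j)) (fun j => φ (q j)) i := by
  simp only [prodCoeff]
  rw [← Polynomial.coeff_map, Polynomial.map_prod]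
  simp

lemma prodCoeff_scale {k : Type*} [Field k] {d : ℕ} (p q : Fin d → k) (hp : ∀ i, p i ≠ 0)
    (i : Fin (d + 1)) :
    prodCoeff p q i = (∏ j, p j) * eval (fun j => q j / p j) (esymm (Fin d) k (d - i)) := by
  have h : ∏ j, (Polynomial.C (p j) * Polynomial.X + Polynomial.C (q j)) =
      Polynomial.C (∏ j, p j) * ∏ j, (Polynomial.X + Polynomial.C (q j / p j)) := by
    rw [map_prod, ← Finset.prod_mul_distrib]
    refine Finset.prod_congr rfl fun j _ => ?_
    rw [mul_add, ← map_mul, mul_div_cancel₀ _ (hp j)]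
  have hi : (i : ℕ) ≤ (Finset.univ : Finset (Fin d)).card := by simp; omega
  rw [prodCoeff, h, Polynomial.coeff_C_mul, Finset.prod_X_add_C_coeff _ _ hi]
  simp [esymm]

lemma prodCoeff_last {k : Type*} [Field k] {d : ℕ} (p q : Fin d → k) :
    prodCoeff p q (Fin.last d) = ∏ j, p j := by
  have := Polynomial.coeff_prod_of_natDegree_le (s := Finset.univ)
    (fun j => (Polynomial.C (p j) * Polynomial.X + Polynomial.C (q j))) 1
    (fun i _ => Polynomial.natDegree_linear_le)
  simp only [Finset.card_univ, Fintype.card_fin, mul_one] at this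
  simp [prodCoeff, this]

lemma cancel_lemma {k : Type*} [Field k] [CharZero k] {d : ℕ}
    (I : MvPolynomial (Fin (d + 1)) k) (W : MvPolynomial (Fin d ⊕ Fin d) k)
    (h : ∀ p q : Fin d → k, (∀ i, p i ≠ 0) → eval (prodCoeff p q) I = eval (Sum.elim p q) W)
    (p q : Fin d → k) : eval (prodCoeff p q) I = eval (Sum.elim p q) W := by
  set A : MvPolynomial (Fin d ⊕ Fin d) k :=
    aeval (prodCoeff (fun j => X (Sum.inl j)) (fun j => X (Sum.inr j))) I with hA
  have hev : ∀ p q : Fin d → k, eval (Sum.elim p q) A = eval (prodCoeff p q) I := by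
    intro p q
    rw [hA, ← coe_aeval_eq_eval, ← coe_aeval_eq_eval]
    simp only [RingHom.coe_coe]
    rw [← AlgHom.comp_apply, comp_aeval]
    congr 2
    funext i
    have := prodCoeff_map ((aeval (Sum.elim p q) : MvPolynomial (Fin d ⊕ Fin d) k →ₐ[k] k) :
        MvPolynomial (Fin d ⊕ Fin d) k →+* k)
      (fun j => X (Sum.inl j)) (fun j => X (Sum.inr j)) i
    simpa using this
  have key : (∏ j : Fin d, (X (Sum.inl j) : MvPolynomial (Fin d ⊕ Fin d) k)) * A =
      (∏ j : Fin d, X (Sum.inl j)) * W := by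
    apply MvPolynomial.funext
    intro x
    obtain ⟨p, q, rfl⟩ : ∃ p q, x = Sum.elim p q :=
      ⟨fun i => x (Sum.inl i), fun i => x (Sum.inr i), by funext i; cases i <;> rfl⟩
    simp only [map_mul, map_prod, eval_X, Sum.elim_inl, hev]
    by_cases hp : ∀ i, p i ≠ 0
    · rw [h p q hp]
    · push Not at hp
      obtain ⟨i, hi⟩ := hp
      rw [Finset.prod_eq_zero (Finset.mem_univ i) hi]
      simp
  have := mul_left_cancel₀ (Finset.prod_ne_zero_iff.2 fun j _ => X_ne_zero _) key
  rw [← hev, this]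

lemma X_dvd_of_vanish {k : Type*} [Field k] [CharZero k] {σ : Type*} [DecidableEq σ] (s : σ)
    (I : MvPolynomial σ k) (h : ∀ a : σ → k, a s = 0 → eval a I = 0) : X s ∣ I := by
  set φ : MvPolynomial σ k →ₐ[k] MvPolynomial σ k :=
    aeval (fun i => if i = s then 0 else X i) with hφ
  have h1 : ∀ J : MvPolynomial σ k, X s ∣ J - φ J := by
    intro J
    induction J using MvPolynomial.induction_on with
    | C a => simp [hφ]
    | add p q hp hq =>
      rw [map_add, add_sub_add_comm]
      exact dvd_add hp hq
    | mul_X p i hp =>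
      have : p * X i - φ (p * X i) = (p - φ p) * X i + φ p * (X i - φ (X i)) := by
        rw [map_mul]; ring
      rw [this]
      refine dvd_add (hp.mul_right _) (Dvd.dvd.mul_left ?_ _)
      by_cases hi : i = s
      · subst hi; simp [hφ]
      · simp [hφ, hi]
  have h2 : φ I = 0 := by
    apply MvPolynomial.funext
    intro x
    rw [map_zero, ← h (fun i => if i = s then 0 else x i) (by simp)]
    rw [hφ, ← coe_aeval_eq_eval, ← coe_aeval_eq_eval]
    simp only [RingHom.coe_coe]
    rw [← AlgHom.comp_apply, comp_aeval]
    congr 2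
    funext i
    split_ifs <;> simp
  have := h1 I
  rwa [h2, sub_zero] at this

lemma descent {k : Type*} [Field k] [IsAlgClosed k] [CharZero k] {d : ℕ} (hd : 1 ≤ d) (n : ℕ)
    (W : MvPolynomial (Fin d ⊕ Fin d) k) (j : ℕ) :
    ∀ I : MvPolynomial (Fin (d + 1)) k, I.IsHomogeneous (n + j) →
    (∀ p q : Fin d → k, eval (prodCoeff p q) I = (∏ i, p i) ^ j * eval (Sum.elim p q) W) →
    ∃ J : MvPolynomial (Fin (d + 1)) k, J.IsHomogeneous n ∧
      ∀ p q : Fin d → k, eval (prodCoeff p q) J = eval (Sum.elim p q) W := by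
  induction j with
  | zero => intro I hI h; exact ⟨I, hI, by simpa using h⟩
  | succ j ih =>
    intro I hI h
    have hdv : X (Fin.last d) ∣ I := by
      apply X_dvd_of_vanish
      intro a ha
      obtain ⟨p, q, rfl⟩ := exists_prodCoeff d hd a
      rw [prodCoeff_last] at ha
      rw [h, ha]; simp
    obtain ⟨J, rfl⟩ := hdv
    refine ih J ?_ ?_
    · intro m hm
      have := @hI (Finsupp.single (Fin.last d) 1 + m) (by rwa [coeff_X_mul])
      rw [map_add] at this
      rw [Finsupp.weight_single] at this
      simp only [Pi.one_apply, smul_eq_mul, mul_one] at this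
      omega
    · have := cancel_lemma J ((∏ i, X (Sum.inl i)) ^ j * W) ?_
      · simpa using this
      · intro p q hp
        have h3 := h p q
        have hne : (∏ i, p i) ≠ 0 := Finset.prod_ne_zero_iff.2 fun i _ => hp i
        rw [map_mul, eval_X, prodCoeff_last, pow_succ', mul_assoc] at h3
        simpa using mul_left_cancel₀ hne h3

lemma exists_form {k : Type*} [Field k] [IsAlgClosed k] [CharZero k] {d : ℕ} (hd : 1 ≤ d) (n : ℕ)
    (W : MvPolynomial (Fin d ⊕ Fin d) k)
    (hsym : ∀ (σ : Equiv.Perm (Fin d)) (p q : Fin d → k),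
      eval (Sum.elim (p ∘ σ) (q ∘ σ)) W = eval (Sum.elim p q) W)
    (hhom : ∀ c p q : Fin d → k, eval (Sum.elim (fun i => c i * p i) (fun i => c i * q i)) W =
      (∏ i, c i) ^ n * eval (Sum.elim p q) W) :
    ∃ J : MvPolynomial (Fin (d + 1)) k, J.IsHomogeneous n ∧
      ∀ p q : Fin d → k, eval (prodCoeff p q) J = eval (Sum.elim p q) W := by
  set w : MvPolynomial (Fin d) k := aeval (Sum.elim (fun _ => 1) X) W with hw
  have hwe : ∀ x : Fin d → k, eval x w = eval (Sum.elim (fun _ => 1) x) W := by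
    intro x
    rw [hw, ← coe_aeval_eq_eval, ← coe_aeval_eq_eval]
    simp only [RingHom.coe_coe]
    rw [← AlgHom.comp_apply, comp_aeval]
    congr 2
    funext i
    cases i <;> simp
  have hws : w.IsSymmetric := by
    intro σ
    apply MvPolynomial.funext
    intro x
    rw [eval_rename, hwe, hwe]
    exact hsym σ (fun _ => 1) x
  obtain ⟨G, hG⟩ := esymmAlgHom_surjective (σ := Fin d) (R := k) (n := d) (by simp) ⟨w, hws⟩
  have hG2 : aeval (fun i : Fin d ↦ esymm (Fin d) k (i + 1)) G = w := by
    rw [← esymmAlgHom_apply, hG]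
  have hwG : ∀ x : Fin d → k, eval x w = eval (fun i : Fin d => eval x (esymm (Fin d) k (i + 1))) G := by
    intro x
    rw [← hG2, ← coe_aeval_eq_eval, ← coe_aeval_eq_eval]
    simp only [RingHom.coe_coe]
    rw [← AlgHom.comp_apply, comp_aeval]
  set t := G.totalDegree with ht
  have hm : ∀ m ∈ G.support, ∑ i, m i ≤ t := by
    intro m hm
    have := le_totalDegree hm
    rwa [Finsupp.sum_fintype _ _ (by simp)] at this
  refine descent hd n W t (∑ m ∈ G.support, C (coeff m G) *
    (X (Fin.last d) ^ (n + t - ∑ i, m i) * ∏ i : Fin d, X (Fin.rev i.succ) ^ m i)) ?_ ?_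
  · refine IsHomogeneous.sum _ _ _ fun m hmm => ?_
    have h1 := hm m hmm
    have e : n + t = 0 + ((n + t - ∑ i, m i) + ∑ i, m i) := by omega
    rw [e]
    refine (isHomogeneous_C _ _).mul (IsHomogeneous.mul ?_ ?_)
    · rw [← e]; exact isHomogeneous_X_pow _ _
    · exact IsHomogeneous.prod _ _ _ fun i _ => isHomogeneous_X_pow _ _
  · have := cancel_lemma (∑ m ∈ G.support, C (coeff m G) *
      (X (Fin.last d) ^ (n + t - ∑ i, m i) * ∏ i : Fin d, X (Fin.rev i.succ) ^ m i))
      ((∏ i, X (Sum.inl i)) ^ t * W) ?_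
    · simpa using this
    · intro p q hp
      have e1 := hhom p (fun _ => 1) (fun i => q i / p i)
      have e2 : (fun i => p i * (q i / p i)) = q := by
        funext i; rw [mul_div_cancel₀ _ (hp i)]
      rw [e2, ← hwe, hwG, eval_eq' _ G] at e1
      simp only [mul_one] at e1
      simp only [map_sum, map_mul, map_pow, map_prod, eval_X, eval_C, Sum.elim_inl, e1]
      rw [← mul_assoc, ← pow_add, Finset.mul_sum]
      refine Finset.sum_congr rfl fun m hmm => ?_
      have h1 := hm m hmm
      have e3 : ∀ i : Fin d, prodCoeff p q (Fin.rev i.succ) =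
          (∏ j, p j) * eval (fun j => q j / p j) (esymm (Fin d) k (i + 1)) := by
        intro i
        rw [prodCoeff_scale p q hp]
        congr 3
        simp [Fin.val_rev]
        omega
      simp only [e3, prodCoeff_last, mul_pow, Finset.prod_mul_distrib, Finset.prod_pow_eq_pow_sum]
      have e4 : (∏ j, p j) ^ (t + n) = (∏ j, p j) ^ (n + t - ∑ i, m i) * (∏ j, p j) ^ (∑ i, m i) := by
        rw [← pow_add]; congr 1; omega
      rw [e4]
      ring

/-- The symmetrised power of the bracket monomial attached to `π`. -/
noncomputable def bracketSum {R : Type*} [CommRing R] {d : ℕ} (π : Fin d → Fin d) (N : ℕ)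
    (p q : Fin d → R) : R :=
  ∑ σ : Equiv.Perm (Fin d),
    (∏ i, (p (σ i) * q (σ (π i)) - q (σ i) * p (σ (π i)))) ^ N

lemma exists_invariant {k : Type*} [Field k] [IsAlgClosed k] [CharZero k] {d : ℕ} (hd : 1 ≤ d)
    (π : Fin d → Fin d) (hπ : Function.Bijective π) (N : ℕ) :
    ∃ J : MvPolynomial (Fin (d + 1)) k, IsBinaryInvariant d (2 * N) J ∧
      ∀ p q : Fin d → k, eval (prodCoeff p q) J = bracketSum π N p q := by
  set W : MvPolynomial (Fin d ⊕ Fin d) k :=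
    bracketSum π N (fun j => X (Sum.inl j)) (fun j => X (Sum.inr j)) with hW
  have hWe : ∀ p q : Fin d → k, eval (Sum.elim p q) W = bracketSum π N p q := by
    intro p q
    simp [hW, bracketSum]
  have hex : ∃ J : MvPolynomial (Fin (d + 1)) k, J.IsHomogeneous (2 * N) ∧
      ∀ p q : Fin d → k, eval (prodCoeff p q) J = eval (Sum.elim p q) W := by
    refine exists_form hd (2 * N) W ?_ ?_
    · intro τ p q
      rw [hWe, hWe]
      exact Fintype.sum_equiv (Equiv.mulLeft τ) _ _ fun σ => by simp
    · intro c p q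
      rw [hWe, hWe, bracketSum, bracketSum, Finset.mul_sum]
      refine Finset.sum_congr rfl fun σ _ => ?_
      rw [pow_mul, ← mul_pow]
      congr 1
      have h1 : ∏ i, c (σ i) = ∏ i, c i := Equiv.prod_comp σ c
      have h2 : ∏ i, c (σ (π i)) = ∏ i, c i := by
        rw [← h1]
        exact Equiv.prod_comp (Equiv.ofBijective π hπ) (fun i => c (σ i))
      rw [pow_two]
      nth_rewrite 1 [← h1]
      rw [← h2, ← Finset.prod_mul_distrib, ← Finset.prod_mul_distrib]
      refine Finset.prod_congr rfl fun i _ => ?_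
      ring
  obtain ⟨J, hJ, hJe⟩ := hex
  · refine ⟨J, ⟨hJ, ?_⟩, fun p q => by rw [hJe, hWe]⟩
    intro a M hM
    obtain ⟨p, q, rfl⟩ := exists_prodCoeff d hd a
    rw [transCoeff_prodCoeff, hJe, hJe, hWe, hWe]
    refine Finset.sum_congr rfl fun σ _ => ?_
    congr 1
    refine Finset.prod_congr rfl fun i _ => ?_
    rw [Matrix.det_fin_two] at hM
    linear_combination (p (σ i) * q (σ (π i)) - q (σ i) * p (σ (π i))) * hM

lemma exists_power_sum {k ι : Type*} [Field k] [CharZero k] [Fintype ι] (z : ι → k) (i₀ : ι)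
    (h : z i₀ ≠ 0) : ∃ N : ℕ, 1 ≤ N ∧ ∑ i, z i ^ N ≠ 0 := by
  classical
  by_contra! hc
  have key : ∀ g : Polynomial k, ∑ i, (z i * g.eval (z i)) = 0 := by
    intro g
    induction g using Polynomial.induction_on' with
    | add p q hp hq => simp [mul_add, Finset.sum_add_distrib, hp, hq]
    | monomial n a =>
      have := hc (n + 1) (by omega)
      have e : ∀ i, z i * (Polynomial.monomial n a).eval (z i) = a * z i ^ (n + 1) := by
        intro i; rw [Polynomial.eval_monomial]; ring
      simp only [e, ← Finset.mul_sum, this, mul_zero]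
  set g : Polynomial k :=
    ∏ w ∈ (Finset.univ.image z).erase (z i₀), (Polynomial.X - Polynomial.C w) with hg
  have hg0 : g.eval (z i₀) ≠ 0 := by
    rw [hg, Polynomial.eval_prod, Finset.prod_ne_zero_iff]
    intro w hw
    simp only [Polynomial.eval_sub, Polynomial.eval_X, Polynomial.eval_C]
    exact sub_ne_zero.2 (Finset.ne_of_mem_erase hw).symm
  have hg1 : ∀ i, z i * g.eval (z i) = if z i = z i₀ then z i₀ * g.eval (z i₀) else 0 := by
    intro i
    split_ifs with hi
    · rw [hi]
    · rw [hg, Polynomial.eval_prod, Finset.prod_eq_zero (i := z i), mul_zero]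
      · simp [hi]
      · simp
  have := key g
  rw [Finset.sum_congr rfl fun i _ => hg1 i, ← Finset.sum_filter, Finset.sum_const, nsmul_eq_mul] at this
  rcases mul_eq_zero.1 this with h' | h'
  · rw [Nat.cast_eq_zero, Finset.card_eq_zero] at h'
    have : i₀ ∈ (Finset.univ.filter fun i => z i = z i₀) := by simp
    rw [h'] at this
    simp at this
  · exact mul_ne_zero h hg0 h'

lemma exists_matching {k : Type*} [Field k] {d : ℕ} (p q : Fin d → k)
    (h0 : ∀ i, p i ≠ 0 ∨ q i ≠ 0)
    (H : ∀ (α β : k) (r : ℕ), (α, β) ≠ (0, 0) →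
        (C β * X 0 - C α * X 1) ^ r ∣
          (∏ j, (C (p j) * X 0 + C (q j) * X 1) : MvPolynomial (Fin 2) k) → 2 * r ≤ d) :
    ∃ π : Fin d → Fin d, Function.Bijective π ∧ ∀ i, p i * q (π i) - q i * p (π i) ≠ 0 := by
  classical
  have hS : ∀ i, 2 * (Finset.univ.filter fun j => p i * q j - q i * p j = 0).card ≤ d := by
    intro i
    refine H (- q i) (p i) _ ?_ ?_
    · intro h
      simp only [Prod.mk.injEq, neg_eq_zero] at h
      rcases h0 i with h' | h' <;> tauto
    · rw [← Finset.prod_const]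
      refine (Finset.prod_dvd_prod_of_dvd _ (fun j => C (p j) * X 0 + C (q j) * X 1) ?_).trans
        (Finset.prod_dvd_prod_of_subset _ _ _ (Finset.filter_subset _ _))
      intro j hj
      simp only [Finset.mem_filter, Finset.mem_univ, true_and] at hj
      rcases h0 i with h' | h'
      · refine ⟨C (p j / p i), ?_⟩
        have e1 : p j = p i * (p j / p i) := by field_simp
        have e2 : q j = q i * (p j / p i) := by field_simp; linear_combination hj
        generalize p j / p i = c at e1 e2 ⊢
        rw [e1, e2]
        simp only [map_mul, map_neg]; ring
      · refine ⟨C (q j / q i), ?_⟩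
        have e1 : p j = p i * (q j / q i) := by field_simp; linear_combination -hj
        have e2 : q j = q i * (q j / q i) := by field_simp
        generalize q j / q i = c at e1 e2 ⊢
        rw [e1, e2]
        simp only [map_mul, map_neg]; ring
  have hall : ∀ A : Finset (Fin d), A.card ≤
      (Finset.univ.filter fun b => ∃ a ∈ A, p a * q b - q a * p b ≠ 0).card := by
    intro A
    rcases A.eq_empty_or_nonempty with rfl | ⟨i, hi⟩
    · simp
    by_cases hj : ∃ j ∈ A, p i * q j - q i * p j ≠ 0
    · obtain ⟨j, hjA, hj⟩ := hj
      refine Finset.card_le_card fun b _ => ?_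
      simp only [Finset.mem_filter, Finset.mem_univ, true_and]
      by_contra! hc
      have h1 := hc i hi
      have h2 := hc j hjA
      apply hj
      rcases h0 b with hb | hb
      · apply mul_left_cancel₀ hb
        linear_combination p j * h1 - p i * h2
      · apply mul_left_cancel₀ hb
        linear_combination q j * h1 - q i * h2
    · push Not at hj
      have h1 : A.card ≤ (Finset.univ.filter fun j => p i * q j - q i * p j = 0).card :=
        Finset.card_le_card fun b hb => by simpa using hj b hb
      have h2 : (Finset.univ.filter fun j => ¬ (p i * q j - q i * p j = 0)).card ≤
          (Finset.univ.filter fun b => ∃ a ∈ A, p a * q b - q a * p b ≠ 0).card := by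
        refine Finset.card_le_card fun b hb => ?_
        simp only [Finset.mem_filter, Finset.mem_univ, true_and] at hb ⊢
        exact ⟨i, hi, hb⟩
      have h3 := Finset.card_filter_add_card_filter_not (s := (Finset.univ : Finset (Fin d)))
        (fun j => p i * q j - q i * p j = 0)
      simp only [Finset.card_univ, Fintype.card_fin] at h3
      have h4 := hS i
      omega
  obtain ⟨π, hπ, h⟩ := (Fintype.all_card_le_filter_rel_iff_exists_injective
    (fun i j => p i * q j - q i * p j ≠ 0)).1 (fun A => by convert hall A)
  exact ⟨π, Finite.injective_iff_bijective.1 hπ, h⟩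

lemma hard_direction {k : Type*} [Field k] [IsAlgClosed k]
    [CharZero k] (d : ℕ) (hd : 1 ≤ d) (a : Fin (d + 1) → k) (ha : a ≠ 0)
    (H : ∀ (α β : k) (r : ℕ), (α, β) ≠ (0, 0) →
        (C β * X 0 - C α * X 1) ^ r ∣ binForm d a → 2 * r ≤ d) :
    ∃ (s : ℕ), 1 ≤ s ∧ ∃ I : MvPolynomial (Fin (d + 1)) k,
        IsBinaryInvariant d s I ∧ MvPolynomial.eval a I ≠ 0 := by
  obtain ⟨p, q, rfl⟩ := exists_prodCoeff d hd a
  have h0 : ∀ i, p i ≠ 0 ∨ q i ≠ 0 := by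
    intro i
    by_contra! hc
    apply ha
    funext j
    rw [prodCoeff, Finset.prod_eq_zero (Finset.mem_univ i) (by simp [hc.1, hc.2])]
    simp
  rw [binForm_prodCoeff] at H
  obtain ⟨π, hπ, hne⟩ := exists_matching p q h0 H
  obtain ⟨N, hN, hs⟩ := exists_power_sum (fun σ : Equiv.Perm (Fin d) =>
    (∏ i, (p (σ i) * q (σ (π i)) - q (σ i) * p (σ (π i))))) 1
    (Finset.prod_ne_zero_iff.2 fun i _ => by simpa using hne i)
  obtain ⟨J, hJ, hJe⟩ := exists_invariant (k := k) hd π hπ N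
  exact ⟨2 * N, by omega, J, hJ, by rw [hJe]; exact hs⟩

lemma easy_direction {k : Type*} [Field k] [CharZero k] (d : ℕ) (a : Fin (d + 1) → k)
    (α β : k) (r : ℕ) (h0 : (α, β) ≠ (0, 0)) (hr : d < 2 * r)
    (hdvd : (C β * X 0 - C α * X 1) ^ r ∣ binForm d a)
    (s : ℕ) (hs : 1 ≤ s) (I : MvPolynomial (Fin (d + 1)) k) (hI : IsBinaryInvariant d s I) :
    eval a I = 0 := by
  obtain ⟨M, hM, hM0, hM1⟩ : ∃ M : Matrix (Fin 2) (Fin 2) k, M.det = 1 ∧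
      β * M 0 0 - α * M 1 0 = 1 ∧ β * M 0 1 - α * M 1 1 = 0 := by
    by_cases hβ : β = 0
    · have hα : α ≠ 0 := by rintro rfl; exact h0 (by rw [hβ])
      refine ⟨!![0, α; -α⁻¹, 0], ?_, ?_, ?_⟩ <;> simp [Matrix.det_fin_two, hβ, hα]
    · refine ⟨!![β⁻¹, α; 0, β], ?_, ?_, ?_⟩ <;> simp [Matrix.det_fin_two, hβ]; ring
  set b := transCoeff M d a with hb
  have hb0 : ∀ i : Fin (d + 1), (i : ℕ) < r → b i = 0 := by
    intro i hi
    have h1 := map_dvd (bind₁ (fun j : Fin 2 =>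
      (C (M j 0) * X 0 + C (M j 1) * X 1 : MvPolynomial (Fin 2) k))) hdvd
    have h2 : bind₁ (fun j : Fin 2 => (C (M j 0) * X 0 + C (M j 1) * X 1 : MvPolynomial (Fin 2) k))
        ((C β * X 0 - C α * X 1 : MvPolynomial (Fin 2) k) ^ r) = monomial (Finsupp.single (0 : Fin 2) r) 1 := by
      rw [← X_pow_eq_monomial, map_pow]
      congr 1
      simp only [map_sub, map_mul, bind₁_C_right, bind₁_X_right]
      have e1 := congrArg (C : k → MvPolynomial (Fin 2) k) hM0
      have e2 := congrArg (C : k → MvPolynomial (Fin 2) k) hM1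
      simp only [map_sub, map_mul, map_one, map_zero] at e1 e2
      linear_combination (X 0 : MvPolynomial (Fin 2) k) * e1 + (X 1 : MvPolynomial (Fin 2) k) * e2
    rw [h2] at h1
    obtain ⟨g, hg⟩ := h1
    rw [hb, transCoeff, hg, coeff_monomial_mul', if_neg]
    intro hle
    have := hle 0
    simp at this
    omega
  have hab : eval b I = eval a I := hI.2 a M hM
  -- the torus action
  have htor : ∀ t : k, t ≠ 0 → eval (fun i : Fin (d + 1) => b i * t ^ (2 * (i : ℕ) - d)) I = eval a I := by
    intro t ht
    rw [← hab, ← hI.2 b !![t, 0; 0, t⁻¹] (by simp [Matrix.det_fin_two, ht])]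
    congr 2
    funext i
    have e : bind₁ (fun j : Fin 2 => C ((!![t, 0; 0, t⁻¹] : Matrix (Fin 2) (Fin 2) k) j 0) * X 0 +
        C ((!![t, 0; 0, t⁻¹] : Matrix (Fin 2) (Fin 2) k) j 1) * X 1) (binForm d b) =
        binForm d (fun i : Fin (d + 1) => b i * (t ^ (i : ℕ) * t⁻¹ ^ (d - (i : ℕ)))) := by
      simp only [binForm, map_sum, map_mul, map_pow, bind₁_C_right, bind₁_X_right]
      refine Finset.sum_congr rfl fun i _ => ?_
      simp
      ring
    rw [transCoeff, e, coeff_binForm]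
    by_cases hi : (i : ℕ) < r
    · simp [hb0 i hi]
    · congr 1
      have : (i : ℕ) = (2 * i - d) + (d - i) := by omega
      conv_rhs => rw [this]
      rw [pow_add, mul_assoc, show d - (2 * (i : ℕ) - d + (d - i)) = d - i by omega, ← mul_pow,
        mul_inv_cancel₀ ht]
      simp
  set P : Polynomial k := aeval (fun i : Fin (d + 1) =>
    Polynomial.C (b i) * Polynomial.X ^ (2 * (i : ℕ) - d)) I with hP
  have hPe : ∀ t, P.eval t = eval (fun i : Fin (d + 1) => b i * t ^ (2 * (i : ℕ) - d)) I := by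
    intro t
    rw [hP, ← Polynomial.coe_aeval_eq_eval, ← coe_aeval_eq_eval]
    simp only [RingHom.coe_coe]
    rw [← AlgHom.comp_apply, comp_aeval]
    congr 2
    funext i
    simp
  have hPC : P = Polynomial.C (eval a I) := by
    have : Polynomial.X * P = Polynomial.X * Polynomial.C (eval a I) := by
      apply Polynomial.funext
      intro t
      by_cases ht : t = 0
      · simp [ht]
      · rw [Polynomial.eval_mul, Polynomial.eval_mul, hPe, htor t ht, Polynomial.eval_C]
    exact mul_left_cancel₀ Polynomial.X_ne_zero this
  have h1 := hPe 0
  rw [hPC, Polynomial.eval_C] at h1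
  rw [h1]
  have hz : (fun i : Fin (d + 1) => b i * (0 : k) ^ (2 * (i : ℕ) - d)) = fun i => (0 : k) * b i := by
    funext i
    by_cases hi : (i : ℕ) < r
    · simp [hb0 i hi]
    · rw [zero_pow (by omega)]; ring
  rw [hz, eval_eq']
  refine Finset.sum_eq_zero fun m hm => ?_
  have hdeg := hI.1 (mem_support_iff.1 hm)
  obtain ⟨i, hi⟩ : ∃ i, m i ≠ 0 := by
    by_contra! hc
    have : m = 0 := Finsupp.ext hc
    rw [this] at hdeg
    simp at hdeg
    omega
  rw [Finset.prod_eq_zero (Finset.mem_univ i) (by simp [hi]), mul_zero]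

/-- over an algebraically closed field `k` of characteristic `0`, a nonzero
binary form `f` of degree `d ≥ 1` has a linear factor of multiplicity `> d/2` if and
only if every homogeneous `SL₂(k)`-invariant of positive degree vanishes at `f`.
Equivalently, `f` is semistable (some positive-degree homogeneous invariant does not
vanish at `f`) if and only if every root of `f` has multiplicity at most `d/2`. -/
theorem unstable_iff_all_invariants_vanish {k : Type*} [Field k] [IsAlgClosed k]
    [CharZero k] (d : ℕ) (hd : 1 ≤ d) (a : Fin (d + 1) → k) (ha : a ≠ 0) :
    ((∃ (α β : k) (r : ℕ), (α, β) ≠ (0, 0) ∧ d < 2 * r ∧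
        (C β * X 0 - C α * X 1) ^ r ∣ binForm d a) ↔
      ∀ (s : ℕ), 1 ≤ s → ∀ I : MvPolynomial (Fin (d + 1)) k,
        IsBinaryInvariant d s I → MvPolynomial.eval a I = 0) ∧
    ((∃ (s : ℕ), 1 ≤ s ∧ ∃ I : MvPolynomial (Fin (d + 1)) k,
        IsBinaryInvariant d s I ∧ MvPolynomial.eval a I ≠ 0) ↔
      ∀ (α β : k) (r : ℕ), (α, β) ≠ (0, 0) →
        (C β * X 0 - C α * X 1) ^ r ∣ binForm d a → 2 * r ≤ d) := by

  have hard := hard_direction d hd a ha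
  constructor
  · constructor
    · rintro ⟨α, β, r, h0, hr, hdvd⟩ s hs I hI
      exact easy_direction d a α β r h0 hr hdvd s hs I hI
    · intro h
      by_contra! hc
      obtain ⟨s, hs, I, hI, hne⟩ := hard fun α β r h0 hdvd => by
        by_contra hlt
        exact hc α β r h0 (by omega) hdvd
      exact hne (h s hs I hI)
  · constructor
    · rintro ⟨s, hs, I, hI, hne⟩ α β r h0 hdvd
      by_contra hlt
      exact hne (easy_direction d a α β r h0 (by omega) hdvd s hs I hI)
    · exact hard
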